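/- For every ε > 0 there exists D such that for every d ≥ D and every triangle-free d-regular graph G on n vertices, log₂ mis(G) ≤ (1+ε) · n/4. -/

import Mathlib

/-- The number of maximal independent sets of a graph `G`. -/
noncomputable def mis {V : Type*} (G : SimpleGraph V) : ℕ :=
  {I : Set V | Maximal (fun s : Set V => s.Pairwise fun a b => ¬ G.Adj a b) I}.ncard

section MaximalIndependentSets

open Finset
open scoped Classical

variable {V : Type*}

/-- The maximal independent sets of the subgraph of `G` induced on the finset `S`. -/
noncomputable def maxIndep (G : SimpleGraph V) (S : Finset V) : Finset (Finset V) :=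
  S.powerset.filter fun I =>
    (∀ a ∈ I, ∀ b ∈ I, ¬ G.Adj a b) ∧ ∀ w ∈ S, w ∉ I → ∃ u ∈ I, G.Adj w u

theorem mem_maxIndep {G : SimpleGraph V} {S I : Finset V} :
    I ∈ maxIndep G S ↔ I ⊆ S ∧ (∀ a ∈ I, ∀ b ∈ I, ¬ G.Adj a b) ∧
      ∀ w ∈ S, w ∉ I → ∃ u ∈ I, G.Adj w u := by
  simp [maxIndep]

/-- The closed neighbourhood of `u` in the subgraph of `G` induced on `S`. -/
noncomputable def closedNbhd (G : SimpleGraph V) (S : Finset V) (u : V) : Finset V :=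
  S.filter fun w => w = u ∨ G.Adj u w

theorem mem_closedNbhd {G : SimpleGraph V} {S : Finset V} {u w : V} :
    w ∈ closedNbhd G S u ↔ w ∈ S ∧ (w = u ∨ G.Adj u w) := by
  simp [closedNbhd]

theorem card_maxIndep_filter_le (G : SimpleGraph V) (S A : Finset V) (u : V) :
    #{I ∈ maxIndep G S | u ∈ I ∧ Disjoint A I} ≤
      #(maxIndep G (S \ (closedNbhd G S u ∪ A))) := by
  apply Finset.card_le_card_of_injOn (fun I => I.erase u)
  · intro I hI
    obtain ⟨hI, hu, hA⟩ := mem_filter.1 hI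
    obtain ⟨hS, hind, hmax⟩ := mem_maxIndep.1 hI
    refine mem_coe.2 (mem_maxIndep.2 ⟨?_, ?_, ?_⟩)
    · intro w hw
      obtain ⟨hwu, hwI⟩ := mem_erase.1 hw
      simp only [mem_sdiff, mem_union, mem_closedNbhd, not_or]
      exact ⟨hS hwI, fun h => h.2.elim hwu (hind u hu w hwI),
        fun h => Finset.disjoint_left.1 hA h hwI⟩
    · intro a ha b hb
      exact hind a (mem_of_mem_erase ha) b (mem_of_mem_erase hb)
    · intro w hw hwI
      simp only [mem_sdiff, mem_union, mem_closedNbhd, not_or, not_and] at hw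
      obtain ⟨hwS, hwN, -⟩ := hw
      obtain ⟨hwu, hadj⟩ := hwN hwS
      obtain ⟨z, hz, hwz⟩ := hmax w hwS fun h => hwI (mem_erase.2 ⟨hwu, h⟩)
      refine ⟨z, mem_erase.2 ⟨?_, hz⟩, hwz⟩
      rintro rfl
      exact hadj hwz.symm
  · intro I hI J hJ h
    have hu := (mem_filter.1 hI).2.1
    have hu' := (mem_filter.1 hJ).2.1
    rw [← insert_erase hu, ← insert_erase hu']
    exact congrArg (insert u) h

theorem natCast_le_sqrt_two_pow {k : ℕ} (h : k ≠ 3) : (k : ℝ) ≤ √2 ^ k := by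
  have h2 : √2 ^ 2 = (2 : ℝ) := Real.sq_sqrt (by norm_num)
  have h1 : (1.25 : ℝ) ≤ √2 := Real.le_sqrt_of_sq_le (by norm_num)
  by_cases hk : 4 ≤ k
  · clear h
    induction k, hk using Nat.le_induction with
    | base => rw [show 4 = 2 * 2 from rfl, pow_mul, h2]; norm_num
    | succ k hk ih =>
      have : (4 : ℝ) ≤ k := by exact_mod_cast hk
      rw [pow_succ]
      push_cast
      nlinarith
  · have : k = 0 ∨ k = 1 ∨ k = 2 := by omega
    rcases this with rfl | rfl | rfl
    · simp
    · norm_num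
    · rw [h2]; norm_num

/-- The Hujter–Tuza bound. -/
theorem card_maxIndep_le_sqrt_two_pow (G : SimpleGraph V) (hG : G.CliqueFree 3) (S : Finset V) :
    (#(maxIndep G S) : ℝ) ≤ √2 ^ #S := by
  have htri : ∀ {a b c}, G.Adj a b → G.Adj a c → ¬ G.Adj b c := fun hab hac hbc =>
    hG _ (SimpleGraph.is3Clique_triple_iff.2 ⟨hab, hac, hbc⟩)
  have s2 : √2 ^ 2 = (2 : ℝ) := Real.sq_sqrt (by norm_num)
  have s1 : (1 : ℝ) ≤ √2 := Real.one_le_sqrt.2 (by norm_num)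
  have s3 : √2 ≤ (1.5 : ℝ) := Real.sqrt_le_iff.2 (by norm_num)
  induction S using Finset.strongInduction with
  | H S ih =>
  rcases S.eq_empty_or_nonempty with rfl | hS
  · have : maxIndep G ∅ ⊆ {∅} := fun I hI =>
      mem_singleton.2 (subset_empty.1 (mem_maxIndep.1 hI).1)
    simpa using card_le_card this
  have bound : ∀ (u : V) (A : Finset V) (k : ℕ), u ∈ S → A ⊆ S → k ≤ #(closedNbhd G S u ∪ A) →
      (#{I ∈ maxIndep G S | u ∈ I ∧ Disjoint A I} : ℝ) * √2 ^ k ≤ √2 ^ #S := by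
    intro u A k hu hA hk
    have hR : closedNbhd G S u ∪ A ⊆ S := union_subset (filter_subset _ _) hA
    have huR : u ∈ closedNbhd G S u ∪ A :=
      mem_union_left _ (mem_closedNbhd.2 ⟨hu, Or.inl rfl⟩)
    have h1 := ih _ (sdiff_ssubset hR ⟨u, huR⟩)
    have h2 : (#{I ∈ maxIndep G S | u ∈ I ∧ Disjoint A I} : ℝ) ≤ _ :=
      Nat.cast_le.2 (card_maxIndep_filter_le G S A u)
    calc _ ≤ √2 ^ #(S \ (closedNbhd G S u ∪ A)) * √2 ^ #(closedNbhd G S u ∪ A) :=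
          mul_le_mul (h2.trans h1) (pow_le_pow_right₀ s1 hk) (by positivity) (by positivity)
      _ = √2 ^ #S := by rw [← pow_add, card_sdiff_add_card_eq_card hR]
  obtain ⟨v, hv, hmin⟩ := exists_min_image S (fun u => #(closedNbhd G S u)) hS
  have hvN : v ∈ closedNbhd G S v := mem_closedNbhd.2 ⟨hv, Or.inl rfl⟩
  have hmeet : ∀ I ∈ maxIndep G S, ∃ u ∈ closedNbhd G S v, u ∈ I := by
    intro I hI
    obtain ⟨hIS, -, hmax⟩ := mem_maxIndep.1 hI
    by_cases hvI : v ∈ I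
    · exact ⟨v, hvN, hvI⟩
    · obtain ⟨u, hu, hvu⟩ := hmax v hv hvI
      exact ⟨u, mem_closedNbhd.2 ⟨hIS hu, Or.inr hvu⟩, hu⟩
  by_cases h3 : #(closedNbhd G S v) = 3
  · have hcard : #((closedNbhd G S v).erase v) = 2 := by rw [card_erase_of_mem hvN, h3]
    obtain ⟨a, b, hab, he⟩ := card_eq_two.1 hcard
    have haS : a ∈ S ∧ G.Adj v a := by
      have : a ∈ (closedNbhd G S v).erase v := by simp [he]
      obtain ⟨h, h'⟩ := mem_erase.1 this
      exact ⟨(mem_closedNbhd.1 h').1, (mem_closedNbhd.1 h').2.resolve_left h⟩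
    have hbS : b ∈ S ∧ G.Adj v b := by
      have : b ∈ (closedNbhd G S v).erase v := by simp [he]
      obtain ⟨h, h'⟩ := mem_erase.1 this
      exact ⟨(mem_closedNbhd.1 h').1, (mem_closedNbhd.1 h').2.resolve_left h⟩
    have haN : a ∉ closedNbhd G S b := fun h =>
      (mem_closedNbhd.1 h).2.elim hab (htri hbS.2 haS.2)
    have hbv := bound v ∅ 3 hv (empty_subset _) (by simp [h3])
    have hba := bound a ∅ 3 haS.1 (empty_subset _) (by simpa [h3] using hmin a haS.1)
    have hbb := bound b {a} 4 hbS.1 (by simpa using haS.1) (by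
      rw [card_union_of_disjoint (by simpa using haN), card_singleton]
      have := hmin b hbS.1
      omega)
    have hsub : maxIndep G S ⊆ {I ∈ maxIndep G S | v ∈ I ∧ Disjoint ∅ I} ∪
        {I ∈ maxIndep G S | a ∈ I ∧ Disjoint ∅ I} ∪
        {I ∈ maxIndep G S | b ∈ I ∧ Disjoint {a} I} := by
      intro I hI
      obtain ⟨u, hu, huI⟩ := hmeet I hI
      rw [← insert_erase hvN, he] at hu
      simp only [mem_insert, mem_singleton] at hu
      simp only [mem_union, mem_filter, hI, true_and, disjoint_empty_left, and_true,
        disjoint_singleton_left]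
      rcases hu with rfl | rfl | rfl <;> tauto
    have hle : (#(maxIndep G S) : ℝ) ≤ #{I ∈ maxIndep G S | v ∈ I ∧ Disjoint ∅ I} +
        #{I ∈ maxIndep G S | a ∈ I ∧ Disjoint ∅ I} +
        #{I ∈ maxIndep G S | b ∈ I ∧ Disjoint {a} I} := by
      have h1 := (card_le_card hsub).trans (card_union_le _ _)
      have h2 := card_union_le {I ∈ maxIndep G S | v ∈ I ∧ Disjoint ∅ I}
        {I ∈ maxIndep G S | a ∈ I ∧ Disjoint ∅ I}
      exact_mod_cast h1.trans (Nat.add_le_add_right h2 _)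
    have s4 : √2 ^ 4 = (4 : ℝ) := by rw [show 4 = 2 * 2 from rfl, pow_mul, s2]; norm_num
    have s5 : √2 ^ 3 = 2 * √2 := by rw [pow_succ, s2]
    rw [s5] at hbv hba
    rw [s4] at hbb
    have hP : 0 ≤ √2 ^ #S := by positivity
    have key : 4 * (#(maxIndep G S) : ℝ) ≤ 2 * √2 * √2 ^ #S + √2 ^ #S := by nlinarith
    nlinarith
  · have hsub : maxIndep G S ⊆ (closedNbhd G S v).biUnion fun u =>
        {I ∈ maxIndep G S | u ∈ I ∧ Disjoint ∅ I} := by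
      intro I hI
      obtain ⟨u, hu, huI⟩ := hmeet I hI
      exact mem_biUnion.2 ⟨u, hu, by simp [hI, huI]⟩
    have hle : (#(maxIndep G S) : ℝ) ≤ ∑ u ∈ closedNbhd G S v,
        (#{I ∈ maxIndep G S | u ∈ I ∧ Disjoint ∅ I} : ℝ) := by
      exact_mod_cast (card_le_card hsub).trans card_biUnion_le
    have hsum : (#(maxIndep G S) : ℝ) * √2 ^ #(closedNbhd G S v) ≤
        #(closedNbhd G S v) * √2 ^ #S := by
      refine (mul_le_mul_of_nonneg_right hle (by positivity)).trans ?_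
      rw [sum_mul, ← nsmul_eq_mul]
      refine sum_le_card_nsmul _ _ _ fun u hu => ?_
      have huS := (mem_closedNbhd.1 hu).1
      exact bound u ∅ _ huS (empty_subset _) (by simpa using hmin u huS)
    have hk : (#(closedNbhd G S v) : ℝ) ≤ √2 ^ #(closedNbhd G S v) :=
      natCast_le_sqrt_two_pow h3
    have hpos : 0 < √2 ^ #(closedNbhd G S v) := by positivity
    refine le_of_mul_le_mul_right (hsum.trans ?_) hpos
    rw [mul_comm]
    exact mul_le_mul_of_nonneg_left hk (by positivity)

variable [Fintype V]

/-- The set of vertices with a neighbour in `T`. -/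
noncomputable def nbhd (G : SimpleGraph V) (T : Finset V) : Finset V :=
  {w | ∃ u ∈ T, G.Adj u w}

/-- The vertices outside the neighbourhood of `T` with fewer than `κ` neighbours outside it. -/
noncomputable def container (G : SimpleGraph V) (κ : ℝ) (T : Finset V) : Finset V :=
  {v | v ∉ nbhd G T ∧ (#(({w | G.Adj v w} : Finset V) \ nbhd G T) : ℝ) < κ}

theorem exists_subset_container (G : SimpleGraph V) {κ : ℝ} (hκ : 0 < κ) {I : Finset V}
    (hI : ∀ a ∈ I, ∀ b ∈ I, ¬ G.Adj a b) :
    ∃ T ⊆ I, #T * κ ≤ #(nbhd G T) ∧ I ⊆ container G κ T := by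
  have hne : (I.powerset.filter fun T => #T * κ ≤ (#(nbhd G T) : ℝ)).Nonempty :=
    ⟨∅, by simp⟩
  obtain ⟨T, hT, hmax⟩ := exists_max_image _ (fun T => #T) hne
  obtain ⟨hTI, hTκ⟩ := mem_filter.1 hT
  rw [mem_powerset] at hTI
  refine ⟨T, hTI, hTκ, fun v hv => ?_⟩
  simp only [container, mem_filter, mem_univ, true_and]
  refine ⟨fun h => ?_, ?_⟩
  · obtain ⟨u, hu, huv⟩ := (mem_filter.1 h).2
    exact hI u (hTI hu) v hv huv
  by_contra! hcon
  have hvT : v ∉ T := by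
    intro hvT
    have : ({w | G.Adj v w} : Finset V) \ nbhd G T = ∅ := by
      rw [sdiff_eq_empty_iff_subset]
      intro w hw
      exact mem_filter.2 ⟨mem_univ _, v, hvT, (mem_filter.1 hw).2⟩
    rw [this] at hcon
    simp only [card_empty, Nat.cast_zero] at hcon
    linarith
  have hn : nbhd G (insert v T) = ({w | G.Adj v w} : Finset V) \ nbhd G T ∪ nbhd G T := by
    rw [sdiff_union_self_eq_union]
    ext w
    simp [nbhd]
  have := hmax (insert v T) (mem_filter.2 ⟨mem_powerset.2 (insert_subset hv hTI), by
    rw [hn, card_union_of_disjoint sdiff_disjoint, card_insert_of_notMem hvT]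
    push_cast
    linarith⟩)
  rw [card_insert_of_notMem hvT] at this
  omega

theorem card_container_mul_le (G : SimpleGraph V) {d : ℕ} {κ : ℝ} (T : Finset V)
    (hd : ∀ v, #({w | G.Adj v w} : Finset V) = d) :
    #(container G κ T) * (2 * d - κ) ≤ d * (Fintype.card V : ℝ) := by
  set C := container G κ T
  set N := nbhd G T
  have h1 : (#C : ℝ) * (d - κ) ≤ ∑ v ∈ C, (#{w ∈ N | G.Adj v w} : ℝ) := by
    rw [← nsmul_eq_mul]
    refine card_nsmul_le_sum _ _ _ fun v hv => ?_
    have h2 := (mem_filter.1 hv).2.2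
    have h3 := card_sdiff_add_card_inter ({w | G.Adj v w} : Finset V) N
    have h4 : ({w | G.Adj v w} : Finset V) ∩ N = {w ∈ N | G.Adj v w} := by
      ext w; simp [and_comm]
    rw [hd, h4] at h3
    have h5 : (#(({w | G.Adj v w} : Finset V) \ N) : ℝ) + #{w ∈ N | G.Adj v w} = d := by
      exact_mod_cast h3
    linarith
  have h2 : ∑ v ∈ C, #{w ∈ N | G.Adj v w} ≤ #N * d := by
    have := sum_card_bipartiteAbove_eq_sum_card_bipartiteBelow (s := C) (t := N)
      (fun v w => G.Adj v w)
    simp only [bipartiteAbove, bipartiteBelow] at this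
    rw [this, ← smul_eq_mul]
    refine sum_le_card_nsmul _ _ _ fun w _ => ?_
    rw [← hd w]
    refine card_le_card fun v hv => ?_
    exact mem_filter.2 ⟨mem_univ _, (mem_filter.1 hv).2.symm⟩
  have h3 : #C + #N ≤ Fintype.card V := by
    have hdis : Disjoint C N := disjoint_left.2 fun v hv => (mem_filter.1 hv).2.1
    rw [← card_union_of_disjoint hdis]
    exact card_le_univ _
  have h2' : ∑ v ∈ C, (#{w ∈ N | G.Adj v w} : ℝ) ≤ #N * d := by exact_mod_cast h2
  have h3' : (#C : ℝ) + #N ≤ Fintype.card V := by exact_mod_cast h3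
  have h4 := mul_le_mul_of_nonneg_right h3' (Nat.cast_nonneg (α := ℝ) d)
  nlinarith

theorem card_small_subsets_mul_rpow_le {x : ℝ} (hx : 0 < x) (hx1 : x ≤ 1) (t : ℝ) :
    (#{T : Finset V | (#T : ℝ) ≤ t} : ℝ) * x ^ t ≤ (1 + x) ^ Fintype.card V := by
  rw [← nsmul_eq_mul]
  calc _ ≤ ∑ T : Finset V with (#T : ℝ) ≤ t, x ^ #T := by
        refine card_nsmul_le_sum _ _ _ fun T hT => ?_
        rw [← Real.rpow_natCast]
        exact Real.rpow_le_rpow_of_exponent_ge hx hx1 (mem_filter.1 hT).2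
    _ ≤ ∑ T : Finset V, x ^ #T :=
        sum_le_sum_of_subset_of_nonneg (filter_subset _ _) fun _ _ _ => by positivity
    _ = (1 + x) ^ Fintype.card V := by
        simpa [add_comm] using Fintype.sum_pow_mul_eq_add_pow V x 1

theorem mis_le_card_maxIndep (G : SimpleGraph V) : mis G ≤ #(maxIndep G univ) := by
  rw [← Set.ncard_coe_finset]
  refine le_trans (Set.ncard_le_ncard ?_ (Set.toFinite _))
    (Set.ncard_image_le (f := fun I : Finset V => (I : Set V)) (Set.toFinite _))
  intro I hI
  obtain ⟨hind, hmax⟩ := hI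
  refine ⟨I.toFinset, mem_coe.2 (mem_maxIndep.2 ⟨subset_univ _, ?_, ?_⟩), by simp⟩
  · intro a ha b hb hab
    exact hind (by simpa using ha) (by simpa using hb) hab.ne hab
  · intro w _ hw
    by_contra! hcon
    simp only [Set.mem_toFinset] at hw hcon
    refine hw (hmax (y := insert w I) ?_ (Set.subset_insert _ _) (Set.mem_insert _ _))
    refine hind.insert fun b hb _ => ⟨hcon b hb, fun h => hcon b hb h.symm⟩

theorem card_maxIndep_univ_mul_rpow_le (G : SimpleGraph V) (hG : G.CliqueFree 3) {d : ℕ}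
    (hd : ∀ v, #({w | G.Adj v w} : Finset V) = d) (hd0 : 0 < d) {δ x : ℝ} (hδ : 0 < δ)
    (hδ1 : δ ≤ 1) (hx : 0 < x) (hx1 : x ≤ 1) :
    (#(maxIndep G univ) : ℝ) * x ^ ((Fintype.card V : ℝ) / (δ * d)) ≤
      (1 + x) ^ Fintype.card V * √2 ^ ((Fintype.card V : ℝ) / (2 - δ)) := by
  have hdR : (0 : ℝ) < d := by exact_mod_cast hd0
  have hκ : 0 < δ * d := by positivity
  set t : ℝ := (Fintype.card V : ℝ) / (δ * d)
  have hsub : maxIndep G univ ⊆ ({T : Finset V | (#T : ℝ) ≤ t} : Finset (Finset V)).biUnion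
      fun T => maxIndep G (container G (δ * d) T) := by
    intro I hI
    obtain ⟨-, hind, hmax⟩ := mem_maxIndep.1 hI
    obtain ⟨T, -, hT, hIT⟩ := exists_subset_container G hκ hind
    refine mem_biUnion.2 ⟨T, mem_filter.2 ⟨mem_univ _, ?_⟩,
      mem_maxIndep.2 ⟨hIT, hind, fun w _ => hmax w (mem_univ _)⟩⟩
    exact (le_div_iff₀ hκ).2 (hT.trans (by exact_mod_cast card_le_univ _))
  have hcont : ∀ T, (#(maxIndep G (container G (δ * d) T)) : ℝ) ≤
      √2 ^ ((Fintype.card V : ℝ) / (2 - δ)) := by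
    intro T
    refine (card_maxIndep_le_sqrt_two_pow G hG _).trans ?_
    rw [← Real.rpow_natCast]
    refine Real.rpow_le_rpow_of_exponent_le (Real.one_le_sqrt.2 (by norm_num)) ?_
    rw [le_div_iff₀ (by linarith)]
    have := card_container_mul_le G (κ := δ * d) T hd
    refine le_of_mul_le_mul_left ?_ hdR
    linarith
  have hle : (#(maxIndep G univ) : ℝ) ≤
      #{T : Finset V | (#T : ℝ) ≤ t} * √2 ^ ((Fintype.card V : ℝ) / (2 - δ)) := by
    have h1 : (#(maxIndep G univ) : ℝ) ≤ ∑ T : Finset V with (#T : ℝ) ≤ t,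
        (#(maxIndep G (container G (δ * d) T)) : ℝ) := by
      exact_mod_cast (card_le_card hsub).trans card_biUnion_le
    rw [← nsmul_eq_mul]
    exact h1.trans (sum_le_card_nsmul _ _ _ fun T _ => hcont T)
  calc _ ≤ (#{T : Finset V | (#T : ℝ) ≤ t} * √2 ^ ((Fintype.card V : ℝ) / (2 - δ))) * x ^ t :=
        mul_le_mul_of_nonneg_right hle (by positivity)
    _ = (#{T : Finset V | (#T : ℝ) ≤ t} * x ^ t) * √2 ^ ((Fintype.card V : ℝ) / (2 - δ)) := by
        ring
    _ ≤ _ := mul_le_mul_of_nonneg_right (card_small_subsets_mul_rpow_le hx hx1 t) (by positivity)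

end MaximalIndependentSets

theorem log_mis_le_of_regular_triangleFree :
    ∀ ε : ℝ, 0 < ε → ∃ D : ℕ, ∀ d : ℕ, D ≤ d →
      ∀ (V : Type) [Fintype V] (G : SimpleGraph V),
        G.CliqueFree 3 →
        (∀ v : V, (G.neighborSet v).ncard = d) →
        Real.logb 2 (mis G) ≤ (1 + ε) * (Fintype.card V : ℝ) / 4 := by
  classical
  intro ε hε
  obtain ⟨e, he0, he1, heε⟩ : ∃ e : ℝ, 0 < e ∧ e ≤ 1 ∧ e ≤ ε :=
    ⟨min ε 1, lt_min hε one_pos, min_le_right _ _, min_le_left _ _⟩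
  have hL : 0 < Real.log 2 := Real.log_pos (by norm_num)
  have hL1 : Real.log 2 < 1 := Real.log_two_lt_d9.trans (by norm_num)
  set x : ℝ := e * Real.log 2 / 16 with hx
  have hx0 : 0 < x := by positivity
  have hx1 : x ≤ 1 := by rw [hx]; nlinarith
  obtain ⟨D, hD⟩ := exists_nat_ge (-Real.log x / (x * (e / 2)))
  refine ⟨D + 1, fun d hd V _ G hG hreg => ?_⟩
  have hd0 : 0 < d := by omega
  have hdR : (0 : ℝ) < d := by exact_mod_cast hd0
  have hDd : (D : ℝ) ≤ d := by exact_mod_cast (by omega : D ≤ d)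
  have hn : (0 : ℝ) ≤ Fintype.card V := Nat.cast_nonneg _
  rcases Nat.eq_zero_or_pos (mis G) with h0 | hpos
  · rw [h0]
    simp only [Nat.cast_zero, Real.logb_zero]
    positivity
  have hdeg : ∀ v, (Finset.univ.filter fun w => G.Adj v w).card = d := by
    intro v
    rw [← hreg v, ← Set.ncard_coe_finset]
    congr 1
    ext w
    simp
  have hmain := card_maxIndep_univ_mul_rpow_le G hG (d := d) (fun v => by convert hdeg v) hd0
    (half_pos he0) (by linarith : e / 2 ≤ 1) hx0 hx1
  have hmpos : (0 : ℝ) < mis G := by exact_mod_cast hpos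
  have hle : (mis G : ℝ) ≤ (maxIndep G Finset.univ).card := by
    exact_mod_cast mis_le_card_maxIndep G
  have hmain' := (mul_le_mul_of_nonneg_right hle (Real.rpow_nonneg hx0.le _)).trans hmain
  have hlog := Real.log_le_log (by positivity) hmain'
  rw [Real.log_mul (by positivity) (by positivity), Real.log_mul (by positivity) (by positivity),
    Real.log_rpow hx0, Real.log_rpow (by positivity), Real.log_pow,
    Real.log_sqrt (by norm_num)] at hlog
  have hA : Real.log (1 + x) ≤ x := by
    have := Real.log_le_sub_one_of_pos (by linarith : 0 < 1 + x)
    linarith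
  have hB : -Real.log x / (e / 2 * d) ≤ x := by
    rw [div_le_iff₀ (by positivity)]
    have := (div_le_iff₀ (by positivity)).1 (hD.trans hDd)
    linarith
  have hC : 1 / (2 - e / 2) ≤ (1 + e / 2) / 2 := by
    rw [div_le_iff₀ (by linarith)]
    nlinarith
  have hA' := mul_le_mul_of_nonneg_left hA hn
  have hB' := mul_le_mul_of_nonneg_left hB hn
  have hC' := mul_le_mul_of_nonneg_left hC (mul_nonneg hn hL.le)
  have hE := mul_le_mul_of_nonneg_left heε (mul_nonneg hn hL.le)
  rw [Real.logb, div_le_iff₀ hL]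
  have e1 : (Fintype.card V : ℝ) * (-Real.log x / (e / 2 * d)) =
      -((Fintype.card V : ℝ) / (e / 2 * d) * Real.log x) := by ring
  have e2 : (Fintype.card V : ℝ) / (2 - e / 2) * (Real.log 2 / 2) =
      Fintype.card V * Real.log 2 * (1 / (2 - e / 2)) / 2 := by ring
  have e3 : (Fintype.card V : ℝ) * x = Fintype.card V * Real.log 2 * e / 16 := by rw [hx]; ring
  rw [e1, e3] at hB'
  rw [e3] at hA'
  rw [e2] at hlog
  linarith
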